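/- arXiv:math/0611003 — 2 statements merged into one kernel-verified Lean document; each statement's English description precedes it below -/
import Mathlib

section
/- The natural homomorphism from the Artin braid group B_n to the presented group G_n sending the Artin generator σ_i to b_i (for i = 1,…,n−1) is injective. -/
/-!
STATEMENT 8: The natural homomorphism from the Artin braid group `B_n` (presented by
generators `σ₁,…,σ_{n−1}` with the braid relations) to the presented group `G_n`
(generators `b₁,…,b_{n−1}, X₁,…,X_n`, relations as in the paper), sending `σᵢ ↦ bᵢ`,
is injective.

`B_n` is `PresentedGroup (braidRels n)`; `G_n` is `PresentedGroup (GnRels n)`. The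
homomorphism is `PresentedGroup.toGroup h` for the generator map `σᵢ ↦ bᵢ`, where `h`
(the — true, and easily verified — fact that the braid relations hold among the `bᵢ`
in `G_n`) is taken as a hypothesis.
-/

noncomputable section

/-- Generators of the presented group `G_n`: `Sum.inl i` is `bᵢ` (`0`-based index
`i : Fin (n-1)`), and `Sum.inr j` is `Xⱼ`. -/
abbrev GnGen (n : ℕ) : Type := Fin (n - 1) ⊕ Fin n

/-- The generator `bᵢ` as an element of the free group. -/
def bb (n : ℕ) (i : Fin (n - 1)) : FreeGroup (GnGen n) := FreeGroup.of (Sum.inl i)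

/-- The generator `Xⱼ` as an element of the free group. -/
def xx (n : ℕ) (j : Fin n) : FreeGroup (GnGen n) := FreeGroup.of (Sum.inr j)

/-- The defining relations of `G_n`, written as words equal to `1`. -/
def GnRels (n : ℕ) : Set (FreeGroup (GnGen n)) :=
  {w | ∃ i j : Fin (n - 1), (j : ℕ) = (i : ℕ) + 1 ∧
        w = bb n i * bb n j * bb n i * (bb n j * bb n i * bb n j)⁻¹} ∪
  {w | ∃ i j : Fin (n - 1), ((i : ℕ) + 2 ≤ (j : ℕ) ∨ (j : ℕ) + 2 ≤ (i : ℕ)) ∧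
        w = bb n i * bb n j * (bb n j * bb n i)⁻¹} ∪
  {w | ∃ j k : Fin n, w = xx n j * xx n k * (xx n k * xx n j)⁻¹} ∪
  {w | ∃ i : Fin (n - 1),
        w = bb n i * xx n ⟨(i : ℕ), by have := i.isLt; omega⟩ * bb n i *
            (xx n ⟨(i : ℕ) + 1, by have := i.isLt; omega⟩)⁻¹}

/-- The braid relations: the Artin braid group `B_n` is `PresentedGroup (braidRels n)`,
with generators `σᵢ`, `i : Fin (n-1)`. -/
def braidRels (n : ℕ) : Set (FreeGroup (Fin (n - 1))) :=
  {w | ∃ i j : Fin (n - 1), (j : ℕ) = (i : ℕ) + 1 ∧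
        w = FreeGroup.of i * FreeGroup.of j * FreeGroup.of i *
            (FreeGroup.of j * FreeGroup.of i * FreeGroup.of j)⁻¹} ∪
  {w | ∃ i j : Fin (n - 1), ((i : ℕ) + 2 ≤ (j : ℕ) ∨ (j : ℕ) + 2 ≤ (i : ℕ)) ∧
        w = FreeGroup.of i * FreeGroup.of j * (FreeGroup.of j * FreeGroup.of i)⁻¹}

/-- The generator map `σᵢ ↦ bᵢ` into `G_n`. -/
def genMap (n : ℕ) : Fin (n - 1) → PresentedGroup (GnRels n) :=
  fun i => PresentedGroup.of (Sum.inl i)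

def jm {G : Type*} [Group G] (s : ℕ → G) : ℕ → G
  | 0 => 1
  | (k+1) => s k * jm s k * s k

theorem jm_comm_low {G : Type*} [Group G] (s : ℕ → G)
    (hc : ∀ i j, i + 2 ≤ j → s i * s j = s j * s i) (j : ℕ) :
    ∀ i, j + 1 ≤ i → Commute (s i) (jm s j) := by
  induction j with
  | zero => intro i _; exact Commute.one_right _
  | succ k ih =>
    intro i hi
    have h1 : Commute (s i) (s k) := (hc k i (by omega)).symm
    exact (h1.mul_right (ih i (by omega))).mul_right h1

theorem jm_comm_high {G : Type*} [Group G] (s : ℕ → G) (m : ℕ)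
    (hc : ∀ i j, i + 2 ≤ j → s i * s j = s j * s i)
    (hb : ∀ i, i + 1 < m → s i * s (i+1) * s i = s (i+1) * s i * s (i+1))
    (i d : ℕ) (hd : i + 2 + d ≤ m) : Commute (s i) (jm s (i + 2 + d)) := by
  induction d with
  | zero =>
    have h1 := hb i (by omega)
    have h2 : s (i+1) * jm s i = jm s i * s (i+1) := jm_comm_low s hc i (i+1) le_rfl
    change s i * (s (i+1) * (s i * jm s i * s i) * s (i+1))
      = (s (i+1) * (s i * jm s i * s i) * s (i+1)) * s i
    calc _ = (s i * s (i+1) * s i) * jm s i * s i * s (i+1) := by group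
      _ = s (i+1) * s i * (s (i+1) * jm s i) * s i * s (i+1) := by rw [h1]; group
      _ = s (i+1) * s i * jm s i * (s (i+1) * s i * s (i+1)) := by rw [h2]; group
      _ = _ := by rw [← h1]; group
  | succ d ih =>
    have h1 : Commute (s i) (s (i + 2 + d)) := hc _ _ (by omega)
    exact (h1.mul_right (ih (by omega))).mul_right h1

theorem jm_comm {G : Type*} [Group G] (s : ℕ → G) (m : ℕ)
    (hc : ∀ i j, i + 2 ≤ j → s i * s j = s j * s i)
    (hb : ∀ i, i + 1 < m → s i * s (i+1) * s i = s (i+1) * s i * s (i+1))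
    (j : ℕ) : ∀ k, j < k → k ≤ m → Commute (jm s j) (jm s k) := by
  induction j with
  | zero => intro k _ _; exact Commute.one_left _
  | succ j ih =>
    intro k hk hm
    have h1 : Commute (s j) (jm s k) := by
      obtain ⟨d, rfl⟩ := Nat.exists_eq_add_of_le (show j + 2 ≤ k by omega)
      exact jm_comm_high s m hc hb j d hm
    exact (h1.mul_left (ih k (by omega) hm)).mul_left h1

def sg (n : ℕ) (i : ℕ) : PresentedGroup (braidRels n) :=
  if h : i < n - 1 then PresentedGroup.of ⟨i, h⟩ else 1

theorem sg_val (n : ℕ) (i : Fin (n - 1)) :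
    sg n i = PresentedGroup.of i := by simp [sg]

theorem sg_comm (n : ℕ) (i j : ℕ) (hij : i + 2 ≤ j) : sg n i * sg n j = sg n j * sg n i := by
  by_cases hj : j < n - 1
  · have hi : i < n - 1 := by omega
    have := PresentedGroup.one_of_mem (rels := braidRels n)
      (Or.inr ⟨⟨i, hi⟩, ⟨j, hj⟩, Or.inl hij, rfl⟩)
    rw [map_mul, map_inv, mul_inv_eq_one, map_mul, map_mul] at this
    simpa [sg, PresentedGroup.of, hi, hj] using this
  · simp [sg, hj]

theorem sg_braid (n : ℕ) (i : ℕ) (hi : i + 1 < n - 1) :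
    sg n i * sg n (i+1) * sg n i = sg n (i+1) * sg n i * sg n (i+1) := by
  have hi' : i < n - 1 := by omega
  have := PresentedGroup.one_of_mem (rels := braidRels n)
    (Or.inl ⟨⟨i, hi'⟩, ⟨i+1, hi⟩, rfl, rfl⟩)
  rw [map_mul, map_inv, mul_inv_eq_one] at this
  simp only [map_mul] at this
  simpa [sg, PresentedGroup.of, hi, hi'] using this

def retGen (n : ℕ) : GnGen n → PresentedGroup (braidRels n)
  | Sum.inl i => sg n i
  | Sum.inr j => jm (sg n) j

theorem retGen_rels (n : ℕ) : ∀ r ∈ GnRels n, FreeGroup.lift (retGen n) r = 1 := by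
  rintro r (((⟨i, j, hij, rfl⟩ | ⟨i, j, hij, rfl⟩) | ⟨j, k, rfl⟩) | ⟨i, rfl⟩) <;>
    rw [map_mul, map_inv, mul_inv_eq_one] <;>
    simp only [map_mul, bb, xx, FreeGroup.lift_apply_of, retGen]
  · rw [hij]
    exact sg_braid n i (by have := j.isLt; omega)
  · rcases hij with hij | hij
    · exact sg_comm n _ _ hij
    · exact (sg_comm n _ _ hij).symm
  · have hj := j.isLt
    have hk := k.isLt
    rcases lt_trichotomy (j : ℕ) k with hl | hl | hl
    · exact jm_comm (sg n) (n-1) (sg_comm n) (sg_braid n) _ _ hl (by omega)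
    · rw [hl]
    · exact (jm_comm (sg n) (n-1) (sg_comm n) (sg_braid n) _ _ hl (by omega)).symm
  · rfl

/-- The natural homomorphism `B_n →* G_n`, `σᵢ ↦ bᵢ`, is injective. -/
theorem braidGroup_to_Gn_injective (n : ℕ)
    (h : ∀ r ∈ braidRels n, FreeGroup.lift (genMap n) r = 1) :
    Function.Injective (PresentedGroup.toGroup h) := by
  have key : (PresentedGroup.toGroup (retGen_rels n)).comp (PresentedGroup.toGroup h)
      = MonoidHom.id _ := by
    ext i
    simp only [MonoidHom.comp_apply, PresentedGroup.toGroup.of, genMap, MonoidHom.id_apply]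
    exact sg_val n i
  exact Function.LeftInverse.injective (g := PresentedGroup.toGroup (retGen_rels n))
    (fun x => DFunLike.congr_fun key x)

end
end

section
/- (The extended double g′ of Section 4.) Let (g, g₊, g₋) be a finite-dimensional Manin triple over ℂ and let d: g → g be a Lie algebra derivation with d(g₊) ⊆ g₊, d(g₋) ⊆ g₋, and ⟨dx, y⟩ + ⟨x, dy⟩ = 0 for all x,y ∈ g. On the vector space g′ := g ⊕ ℂt ⊕ ℂt* define a bilinear bracket by: [x,y]′ := [x,y]_g + ⟨dx, y⟩·t* for x,y ∈ g; [t,x]′ := d(x) and [x,t]′ := −d(x) for x ∈ g; and t* central ([t*, g′]′ = 0, [t,t]′ = [t,t*]′ = 0). Then: (1) this bracket is alternating and satisfies the Jacobi identity, making g′ a Lie algebra; (2) the symmetric bilinear form on g′ extending ⟨·,·⟩ by ⟨t,t*⟩ = ⟨t*,t⟩ = 1, ⟨t,t⟩ = ⟨t*,t*⟩ = 0, and ⟨t,g⟩ = ⟨t*,g⟩ = 0 is nondegenerate and invariant for this bracket; (3) g′₊ := g₊ ⊕ ℂt* and g′₋ := g₋ ⊕ ℂt are isotropic Lie subalgebras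 of g′ with g′ = g′₊ ⊕ g′₋, so (g′, g′₊, g′₋) is a Manin triple. -/
/-!
STATEMENT 12 (The extended double `g′` of Section 4):
Let `(g, g₊, g₋)` be a finite-dimensional Manin triple over `ℂ` and `d : g → g` a Lie
algebra derivation with `d(g₊) ⊆ g₊`, `d(g₋) ⊆ g₋`, and `⟨dx, y⟩ + ⟨x, dy⟩ = 0`.
On `g′ = g ⊕ ℂt ⊕ ℂt*` define the bracket
`[x,y]′ = [x,y]_g + ⟨dx,y⟩·t*`, `[t,x]′ = d(x)`, `[x,t]′ = −d(x)`, `t*` central.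
Then: (1) this bracket is bilinear, alternating and satisfies the Jacobi identity;
(2) the symmetric bilinear form extending `⟨·,·⟩` by `⟨t,t*⟩ = 1`, `⟨t,t⟩ = ⟨t*,t*⟩ = 0`,
`⟨t,g⟩ = ⟨t*,g⟩ = 0` is nondegenerate and invariant;
(3) `g′₊ = g₊ ⊕ ℂt*` and `g′₋ = g₋ ⊕ ℂt` are isotropic subalgebras with `g′ = g′₊ ⊕ g′₋`.

We model `g′` as `g × ℂ × ℂ`, where `(x, a, b)` stands for `x + a·t + b·t*`.
-/

noncomputable section

variable {g : Type*} [LieRing g] [LieAlgebra ℂ g]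

/-- The bracket of the extended double `g′ = g ⊕ ℂt ⊕ ℂt*`:
`[x + a t + b t*, y + c t + e t*]′ = ([x,y]_g + a·d(y) − c·d(x)) + ⟨d(x), y⟩ t*`. -/
def extBracket (B : g →ₗ[ℂ] g →ₗ[ℂ] ℂ) (d : g →ₗ[ℂ] g) :
    g × ℂ × ℂ → g × ℂ × ℂ → g × ℂ × ℂ :=
  fun X Y => (⁅X.1, Y.1⁆ + X.2.1 • d Y.1 - Y.2.1 • d X.1, 0, B (d X.1) Y.1)

/-- The extension of the invariant form to `g′`:
`⟨x + a t + b t*, y + c t + e t*⟩′ = ⟨x,y⟩ + a·e + b·c`. -/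
def extForm (B : g →ₗ[ℂ] g →ₗ[ℂ] ℂ) : g × ℂ × ℂ → g × ℂ × ℂ → ℂ :=
  fun X Y => B X.1 Y.1 + X.2.1 * Y.2.2 + X.2.2 * Y.2.1

/-- `g′₊ = g₊ ⊕ ℂt*`, as a subspace of `g′ = g × ℂ × ℂ`. -/
def extPlus (gp : LieSubalgebra ℂ g) : Submodule ℂ (g × ℂ × ℂ) :=
  gp.toSubmodule.prod ((⊥ : Submodule ℂ ℂ).prod (⊤ : Submodule ℂ ℂ))

/-- `g′₋ = g₋ ⊕ ℂt`, as a subspace of `g′ = g × ℂ × ℂ`. -/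
def extMinus (gm : LieSubalgebra ℂ g) : Submodule ℂ (g × ℂ × ℂ) :=
  gm.toSubmodule.prod ((⊤ : Submodule ℂ ℂ).prod (⊥ : Submodule ℂ ℂ))

theorem extended_double_is_manin_triple [FiniteDimensional ℂ g]
    (B : g →ₗ[ℂ] g →ₗ[ℂ] ℂ)
    (hsymm : ∀ x y : g, B x y = B y x)
    (hinv : ∀ x y z : g, B ⁅x, y⁆ z = B x ⁅y, z⁆)
    (hnondeg : ∀ x : g, (∀ y : g, B x y = 0) → x = 0)
    (gp gm : LieSubalgebra ℂ g)
    (hgp_iso : ∀ x ∈ gp, ∀ y ∈ gp, B x y = 0)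
    (hgm_iso : ∀ x ∈ gm, ∀ y ∈ gm, B x y = 0)
    (hcompl : IsCompl gp.toSubmodule gm.toSubmodule)
    (d : g →ₗ[ℂ] g)
    (hd : ∀ x y : g, d ⁅x, y⁆ = ⁅d x, y⁆ + ⁅x, d y⁆)
    (hdp : ∀ x ∈ gp, d x ∈ gp) (hdm : ∀ x ∈ gm, d x ∈ gm)
    (hdskew : ∀ x y : g, B (d x) y + B x (d y) = 0) :
    -- (1) the bracket is bilinear, alternating, and satisfies the Jacobi identity
    ((∀ (X X' Y : g × ℂ × ℂ), extBracket B d (X + X') Y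
        = extBracket B d X Y + extBracket B d X' Y) ∧
     (∀ (c : ℂ) (X Y : g × ℂ × ℂ), extBracket B d (c • X) Y = c • extBracket B d X Y) ∧
     (∀ (X Y Y' : g × ℂ × ℂ), extBracket B d X (Y + Y')
        = extBracket B d X Y + extBracket B d X Y') ∧
     (∀ (c : ℂ) (X Y : g × ℂ × ℂ), extBracket B d X (c • Y) = c • extBracket B d X Y) ∧
     (∀ X : g × ℂ × ℂ, extBracket B d X X = 0) ∧
     (∀ X Y Z : g × ℂ × ℂ,
        extBracket B d (extBracket B d X Y) Z +
        extBracket B d (extBracket B d Y Z) X +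
        extBracket B d (extBracket B d Z X) Y = 0)) ∧
    -- (2) the extended form is symmetric, nondegenerate, and invariant
    ((∀ X Y : g × ℂ × ℂ, extForm B X Y = extForm B Y X) ∧
     (∀ X : g × ℂ × ℂ, (∀ Y : g × ℂ × ℂ, extForm B X Y = 0) → X = 0) ∧
     (∀ X Y Z : g × ℂ × ℂ, extForm B (extBracket B d X Y) Z
        = extForm B X (extBracket B d Y Z))) ∧
    -- (3) `g′₊` and `g′₋` are isotropic subalgebras with `g′ = g′₊ ⊕ g′₋`
    ((∀ X ∈ extPlus gp, ∀ Y ∈ extPlus gp, extBracket B d X Y ∈ extPlus gp) ∧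
     (∀ X ∈ extMinus gm, ∀ Y ∈ extMinus gm, extBracket B d X Y ∈ extMinus gm) ∧
     (∀ X ∈ extPlus gp, ∀ Y ∈ extPlus gp, extForm B X Y = 0) ∧
     (∀ X ∈ extMinus gm, ∀ Y ∈ extMinus gm, extForm B X Y = 0) ∧
     IsCompl (extPlus gp) (extMinus gm)) := by
  have hsk : ∀ x y : g, B (d x) y = - B x (d y) := fun x y =>
    eq_neg_of_add_eq_zero_left (hdskew x y)
  refine ⟨⟨?_, ?_, ?_, ?_, ?_, ?_⟩, ⟨?_, ?_, ?_⟩, ?_, ?_, ?_, ?_, ?_⟩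
  · rintro ⟨x, a, b⟩ ⟨x', a', b'⟩ ⟨y, c, e⟩
    simp only [extBracket, Prod.mk_add_mk, Prod.mk.injEq, map_add, add_lie,
      LinearMap.add_apply, add_zero, and_true]
    module
  · rintro k ⟨x, a, b⟩ ⟨y, c, e⟩
    simp only [extBracket, Prod.smul_mk, Prod.mk.injEq, map_smul, smul_lie,
      LinearMap.smul_apply, smul_eq_mul, mul_zero, true_and, and_true]
    module
  · rintro ⟨x, a, b⟩ ⟨y, c, e⟩ ⟨y', c', e'⟩
    simp only [extBracket, Prod.mk_add_mk, Prod.mk.injEq, map_add, lie_add,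
      LinearMap.add_apply, add_zero, and_true]
    module
  · rintro k ⟨x, a, b⟩ ⟨y, c, e⟩
    simp only [extBracket, Prod.smul_mk, Prod.mk.injEq, map_smul, lie_smul,
      LinearMap.smul_apply, smul_eq_mul, mul_zero, true_and, and_true]
    module
  · rintro ⟨x, a, b⟩
    have h := hdskew x x
    rw [hsymm x (d x)] at h
    have h0 : B (d x) x = 0 := by linear_combination h / 2
    simp [extBracket, h0]
  · rintro ⟨x, a, b⟩ ⟨y, c, e⟩ ⟨z, f, k⟩
    simp only [extBracket, Prod.mk_add_mk, Prod.mk_eq_zero]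
    refine ⟨?_, by simp, ?_⟩
    · have hj : ⁅⁅x, y⁆, z⁆ + ⁅⁅y, z⁆, x⁆ + ⁅⁅z, x⁆, y⁆ = 0 := by
        have h := lie_jacobi x y z
        rw [← lie_skew x ⁅y, z⁆, ← lie_skew y ⁅z, x⁆, ← lie_skew z ⁅x, y⁆] at h
        rw [← neg_eq_zero, ← h]; abel
      simp only [map_add, map_sub, map_smul, hd, add_lie, sub_lie, smul_lie, zero_smul, add_zero]
      rw [← lie_skew (d x) z, ← lie_skew (d y) x, ← lie_skew (d z) y]
      linear_combination (norm := module) (1 : ℂ) • hj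
    · have h2 : ∀ u v : g, B (d (d u)) v = B (d (d v)) u := fun u v => by
        rw [hsk, hsk u, neg_neg, hsymm]
      have e1 : B (d ⁅x, y⁆) z = - B (d z) ⁅x, y⁆ := by rw [hsk, hsymm]
      have e2 : B (d ⁅y, z⁆) x = - B (d x) ⁅y, z⁆ := by rw [hsk, hsymm]
      have e3 : B (d ⁅z, x⁆) y = - B (d y) ⁅z, x⁆ := by rw [hsk, hsymm]
      have k : ∀ u v w : g, B (d ⁅u, v⁆) w = B (d u) ⁅v, w⁆ + B (d v) ⁅w, u⁆ := fun u v w => by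
        rw [hd, map_add, LinearMap.add_apply, hinv, hsymm ⁅u, d v⁆ w, ← hinv w, hsymm _ (d v)]
      have f1 := k x y z
      have f2 := k y z x
      have f3 := k z x y
      simp only [map_add, map_sub, map_smul, LinearMap.add_apply, LinearMap.sub_apply,
        LinearMap.smul_apply, smul_eq_mul]
      linear_combination a * h2 y z + c * h2 z x + f * h2 x y +
        (2 * e1 + 2 * e2 + 2 * e3 + f1 + f2 + f3) / 3
  · rintro ⟨x, a, b⟩ ⟨y, c, e⟩
    simp only [extForm]
    rw [hsymm x y]; ring
  · rintro ⟨x, a, b⟩ h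
    have hx : x = 0 := hnondeg x fun y => by simpa [extForm] using h (y, 0, 0)
    have ha : a = 0 := by simpa [extForm] using h (0, 0, 1)
    have hb : b = 0 := by simpa [extForm] using h (0, 1, 0)
    simp [hx, ha, hb]
  · rintro ⟨x, a, b⟩ ⟨y, c, e⟩ ⟨z, f, k⟩
    simp only [extForm, extBracket, map_add, map_sub, map_smul, LinearMap.add_apply,
      LinearMap.sub_apply, LinearMap.smul_apply, smul_eq_mul]
    linear_combination hinv x y z - c * hdskew x z + f * hdskew x y
  · rintro ⟨x, a, b⟩ ⟨hx, ha, -⟩ ⟨y, c, e⟩ ⟨hy, hc, -⟩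
    exact ⟨sub_mem (add_mem (gp.lie_mem hx hy) (gp.smul_mem _ (hdp _ hy)))
      (gp.smul_mem _ (hdp _ hx)), Submodule.zero_mem _, trivial⟩
  · rintro ⟨x, a, b⟩ ⟨hx, -, hb⟩ ⟨y, c, e⟩ ⟨hy, -, he⟩
    refine ⟨sub_mem (add_mem (gm.lie_mem hx hy) (gm.smul_mem _ (hdm _ hy)))
      (gm.smul_mem _ (hdm _ hx)), trivial, ?_⟩
    exact hgm_iso _ (hdm _ hx) _ hy
  · rintro ⟨x, a, b⟩ ⟨hx, ha, -⟩ ⟨y, c, e⟩ ⟨hy, hc, -⟩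
    have ha' : a = 0 := ha
    have hc' : c = 0 := hc
    simp [extForm, ha', hc', hgp_iso x hx y hy]
  · rintro ⟨x, a, b⟩ ⟨hx, -, hb⟩ ⟨y, c, e⟩ ⟨hy, -, he⟩
    have hb' : b = 0 := hb
    have he' : e = 0 := he
    simp [extForm, hb', he', hgm_iso x hx y hy]
  · refine IsCompl.of_eq ?_ ?_
    · simp only [extPlus, extMinus, Submodule.prod_inf_prod, hcompl.inf_eq_bot, bot_inf_eq,
        inf_bot_eq, Submodule.prod_bot]
    · simp only [extPlus, extMinus, Submodule.prod_sup_prod, hcompl.sup_eq_top, bot_sup_eq,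
        sup_bot_eq, Submodule.prod_top]

end
end
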